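/- Let 𝒢 be a (t,s,ℓ,B⃗)-weak-builder with (B_s − ℓ)/(C(t,s)·ℓ) ≥ 1/(1 − 2^{−1/r}). Then 𝒢 is a (t,s,ℓ,r,B⃗/2)-strong-builder; that is, for every set S of at most r ground-set elements, 𝒢 \ S is a (t,s,ℓ,B⃗/2)-weak-builder. -/

import Mathlib

open Finset

/-- A `t`-complex: a collection of nonempty sets of size at most `t`, closed under
taking nonempty subsets. -/
def IsTComplex {V : Type*} (t : ℕ) (𝒢 : Finset (Finset V)) : Prop :=
  ∀ K ∈ 𝒢, K.Nonempty ∧ K.card ≤ t ∧ ∀ K' : Finset V, K' ⊆ K → K'.Nonempty → K' ∈ 𝒢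

/-- The degree of `K` in the `t`-complex `𝒢`: the number of sets of size `t` in `𝒢`
containing `K`. -/
def complexDeg {V : Type*} [DecidableEq V] (t : ℕ) (𝒢 : Finset (Finset V))
    (K : Finset V) : ℕ :=
  (𝒢.filter (fun L => L.card = t ∧ K ⊆ L)).card

/-- A `(t,s,ℓ,B)`-weak-builder. -/
def IsWeakBuilder {V : Type*} [DecidableEq V] (t s ℓ : ℕ) (B : ℕ → ℝ)
    (𝒢 : Finset (Finset V)) : Prop :=
  IsTComplex t 𝒢 ∧
  (∀ i, 1 ≤ i → i ≤ s → ∀ K ∈ 𝒢, K.card = i → B i ≤ (complexDeg t 𝒢 K : ℝ)) ∧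
  (∀ K ∈ 𝒢, K.card = s + 1 → (complexDeg t 𝒢 K : ℝ) ≤ (ℓ : ℝ))

/-- `𝒢 \ S` for a `t`-complex: remove the elements of `S` from every set, discarding
sets contained in `S`. -/
def complexRemove {V : Type*} [DecidableEq V] (𝒢 : Finset (Finset V)) (S : Finset V) :
    Finset (Finset V) :=
  (𝒢.filter (fun K => ¬ K ⊆ S)).image (fun K => K \ S)

/-- A `(t,s,ℓ,r,B)`-strong-builder. -/
def IsStrongBuilder {V : Type*} [DecidableEq V] (t s ℓ r : ℕ) (B : ℕ → ℝ)
    (𝒢 : Finset (Finset V)) : Prop :=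
  ∀ S : Finset V, S.card ≤ r → IsWeakBuilder t s ℓ B (complexRemove 𝒢 S)

lemma wb_choose_ge (t s : ℕ) (h1 : 1 ≤ s) (h2 : s < t) : t ≤ t.choose s := by
  induction t with
  | zero => omega
  | succ n ih =>
    obtain ⟨k, rfl⟩ : ∃ k, s = k + 1 := ⟨s - 1, by omega⟩
    rw [Nat.choose_succ_succ]
    by_cases h : k + 1 < n
    · have := ih h
      have h3 : 0 < n.choose k := Nat.choose_pos (by omega)
      simp only [Nat.succ_eq_add_one] at *
      omega
    · have : n = k + 1 := by omega
      subst this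
      simp

lemma wb_choose_ratio (n k : ℕ) (h : k ≤ n) : (n + 1).choose k ≤ (n + 1) * n.choose k := by
  have h1 := Nat.choose_mul_succ_eq n k
  have h2 : 1 ≤ n + 1 - k := by omega
  nlinarith [Nat.mul_le_mul_left ((n + 1).choose k) h2]

lemma wb_remove_eq {V : Type*} [DecidableEq V] (t : ℕ) (G : Finset (Finset V))
    (hG : IsTComplex t G) (S : Finset V) :
    complexRemove G S = G.filter (fun K => Disjoint K S) := by
  ext K
  simp only [complexRemove, mem_image, mem_filter]
  constructor
  · rintro ⟨L, ⟨hL, hLS⟩, rfl⟩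
    refine ⟨(hG L hL).2.2 _ sdiff_subset ?_, sdiff_disjoint⟩
    exact sdiff_nonempty.2 hLS
  · rintro ⟨hK, hd⟩
    refine ⟨K, ⟨hK, fun h => ?_⟩, sdiff_eq_self_of_disjoint hd⟩
    have := (hG K hK).1
    rw [disjoint_of_le_iff_left_eq_bot h] at hd
    subst hd
    simp at this

lemma wb_filter_complex {V : Type*} [DecidableEq V] (t : ℕ) (G : Finset (Finset V))
    (hG : IsTComplex t G) (S : Finset V) :
    IsTComplex t (G.filter (fun K => Disjoint K S)) := by
  intro K hK
  rw [mem_filter] at hK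
  refine ⟨(hG K hK.1).1, (hG K hK.1).2.1, fun K' h h' => ?_⟩
  rw [mem_filter]
  exact ⟨(hG K hK.1).2.2 K' h h', disjoint_of_subset_left h hK.2⟩

lemma wb_deg_split {V : Type*} [DecidableEq V] (t : ℕ) (G : Finset (Finset V))
    (K : Finset V) (v : V) :
    complexDeg t G K = complexDeg t G (insert v K)
      + complexDeg t (G.filter (fun L => v ∉ L)) K := by
  unfold complexDeg
  rw [← card_filter_add_card_filter_not (s := G.filter (fun L => L.card = t ∧ K ⊆ L))
    (fun L => v ∈ L)]
  congr 2
  · ext L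
    simp only [mem_filter, insert_subset_iff]
    tauto
  · ext L
    simp only [mem_filter]
    tauto

lemma wb_deg_insert_le {V : Type*} [DecidableEq V] (t s ℓ : ℕ) (G : Finset (Finset V))
    (hG : IsTComplex t G)
    (hl : ∀ K ∈ G, K.card = s + 1 → complexDeg t G K ≤ ℓ)
    (M : Finset V) (v : V) (hM : M.card = s) (hv : v ∉ M) :
    complexDeg t G (insert v M) ≤ ℓ := by
  by_cases h : insert v M ∈ G
  · exact hl _ h (by rw [card_insert_of_notMem hv, hM])
  · have : complexDeg t G (insert v M) = 0 := by
      unfold complexDeg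
      rw [card_eq_zero, filter_eq_empty_iff]
      rintro L hL ⟨-, hsub⟩
      exact h ((hG L hL).2.2 _ hsub (insert_nonempty _ _))
    omega

lemma wb_step {V : Type*} [DecidableEq V] (t s ℓ : ℕ) (hs : s < t) (b : ℝ)
    (G : Finset (Finset V)) (hG : IsTComplex t G)
    (hb : ∀ K ∈ G, K.card = s → b ≤ (complexDeg t G K : ℝ))
    (hl : ∀ K ∈ G, K.card = s + 1 → complexDeg t G K ≤ ℓ) (hbl : (ℓ : ℝ) ≤ b)
    (K : Finset V) (hK1 : 1 ≤ K.card) (hKs : K.card ≤ s) (v : V) (hv : v ∉ K) :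
    (b - ℓ) * (complexDeg t G (insert v K) : ℝ)
      ≤ ((t : ℝ) - 1) * ℓ * (complexDeg t (G.filter (fun L => v ∉ L)) K : ℝ) := by
  set A := G.filter (fun L => L.card = t ∧ insert v K ⊆ L) with hA
  set D := (G.filter (fun L => v ∉ L)).filter (fun L => L.card = t ∧ K ⊆ L) with hD
  set Ms := G.filter (fun M => M.card = s ∧ K ⊆ M ∧ v ∉ M ∧ insert v M ∈ G) with hMs
  set c1 := (t - K.card - 1).choose (s - K.card) with hc1
  set c2 := (t - K.card).choose (s - K.card) with hc2
  change (b - ℓ) * (A.card : ℝ) ≤ ((t : ℝ) - 1) * ℓ * (D.card : ℝ)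
  have hc1pos : 0 < c1 := Nat.choose_pos (by omega)
  have hc : c2 ≤ (t - 1) * c1 := by
    have := wb_choose_ratio (t - K.card - 1) (s - K.card) (by omega)
    rw [show t - K.card - 1 + 1 = t - K.card by omega] at this
    exact this.trans (Nat.mul_le_mul_right _ (by omega))
  have h1 : A.card * c1 ≤ Ms.card * ℓ := by
    refine card_mul_le_card_mul' (fun M L : Finset V => M ⊆ L) ?_ ?_
    · intro L hL
      simp only [hA, mem_filter, insert_subset_iff] at hL
      obtain ⟨hLG, hLt, hvL, hKL⟩ := hL
      have hcard : (powersetCard (s - K.card) ((L \ K).erase v)).card = c1 := by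
        rw [card_powersetCard, card_erase_of_mem (by simp [hvL, hv]),
          card_sdiff_of_subset hKL, hLt]
      rw [← hcard]
      refine card_le_card_of_injOn (fun X => K ∪ X) ?_ ?_
      · intro X hX
        rw [mem_coe, mem_powersetCard] at hX
        obtain ⟨hXs, hXc⟩ := hX
        have hdis : Disjoint K X := by
          rw [disjoint_left]
          intro a ha haX
          have := hXs haX
          simp at this
          tauto
        have hvX : v ∉ X := fun h => by simpa using hXs h
        have hXL : X ⊆ L := fun a ha => by
          have := hXs ha
          simp at this
          tauto
        have hUL : K ∪ X ⊆ L := union_subset hKL hXL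
        have hne : (K ∪ X).Nonempty := by
          rw [← card_pos, card_union_of_disjoint hdis]; omega
        simp only [bipartiteBelow, coe_filter, Set.mem_ofPred_eq, hMs, mem_filter]
        refine ⟨⟨(hG L hLG).2.2 _ hUL hne, ?_, subset_union_left, ?_, ?_⟩, hUL⟩
        · rw [card_union_of_disjoint hdis]; omega
        · simp [hv, hvX]
        · exact (hG L hLG).2.2 _ (insert_subset hvL hUL) (insert_nonempty _ _)
      · intro X hX Y hY hXY
        rw [mem_coe, mem_powersetCard] at hX hY
        ext a
        have hx := fun h : a ∈ X => hX.1 h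
        have hy := fun h : a ∈ Y => hY.1 h
        have := congrArg (fun Z => a ∈ Z) hXY
        simp at this hx hy
        tauto
    · intro M hM
      simp only [hMs, mem_filter] at hM
      obtain ⟨hMG, hMc, hKM, hvM, hins⟩ := hM
      refine le_trans (card_le_card ?_) (wb_deg_insert_le t s ℓ G hG hl M v hMc hvM)
      intro L hL
      simp only [bipartiteAbove, hA, mem_filter, insert_subset_iff] at hL ⊢
      tauto
  have h2 : (Ms.card : ℝ) * (b - ℓ) ≤ D.card * c2 := by
    have e := sum_card_bipartiteAbove_eq_sum_card_bipartiteBelow (s := Ms) (t := D)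
      (fun M L : Finset V => M ⊆ L)
    have u : ∑ L ∈ D, (bipartiteBelow (fun M L : Finset V => M ⊆ L) Ms L).card
        ≤ D.card * c2 := by
      rw [← smul_eq_mul]
      refine sum_le_card_nsmul _ _ _ ?_
      intro L hL
      simp only [hD, mem_filter] at hL
      obtain ⟨⟨hLG, hvL⟩, hLt, hKL⟩ := hL
      have hcard : (powersetCard (s - K.card) (L \ K)).card = c2 := by
        rw [card_powersetCard, card_sdiff_of_subset hKL, hLt]
      rw [← hcard]
      refine card_le_card_of_injOn (fun X => X \ K) ?_ ?_
      · intro X hX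
        simp only [bipartiteBelow, coe_filter, Set.mem_ofPred_eq, hMs, mem_filter] at hX
        rw [mem_coe, mem_powersetCard, card_sdiff_of_subset hX.1.2.2.1, hX.1.2.1]
        exact ⟨sdiff_subset_sdiff hX.2 subset_rfl, rfl⟩
      · intro X hX Y hY hXY
        simp only [bipartiteBelow, coe_filter, Set.mem_ofPred_eq, hMs, mem_filter] at hX hY
        ext a
        have hx := fun h : a ∈ K => hX.1.2.2.1 h
        have hy := fun h : a ∈ K => hY.1.2.2.1 h
        have := congrArg (fun Z => a ∈ Z) hXY
        simp at this
        tauto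
    have w : (Ms.card : ℝ) * (b - ℓ)
        ≤ ∑ M ∈ Ms, ((bipartiteAbove (fun M L : Finset V => M ⊆ L) D M).card : ℝ) := by
      rw [← nsmul_eq_mul]
      refine card_nsmul_le_sum _ _ _ ?_
      intro M hM
      simp only [hMs, mem_filter] at hM
      obtain ⟨hMG, hMc, hKM, hvM, hins⟩ := hM
      have q1 := hb M hMG hMc
      have q2 := wb_deg_insert_le t s ℓ G hG hl M v hMc hvM
      have q3 := wb_deg_split t G M v
      have q4 : complexDeg t (G.filter (fun L => v ∉ L)) M
          ≤ (bipartiteAbove (fun M L : Finset V => M ⊆ L) D M).card := by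
        refine card_le_card ?_
        intro L hL
        simp only [bipartiteAbove, hD, mem_filter] at hL ⊢
        exact ⟨⟨hL.1, hL.2.1, hKM.trans hL.2.2⟩, hL.2.2⟩
      have q5 : complexDeg t G M
          ≤ ℓ + (bipartiteAbove (fun M L : Finset V => M ⊆ L) D M).card := by omega
      have q6 : (complexDeg t G M : ℝ)
          ≤ ℓ + ((bipartiteAbove (fun M L : Finset V => M ⊆ L) D M).card : ℝ) := by
        exact_mod_cast q5
      linarith
    refine w.trans ?_
    rw [← Nat.cast_sum, e]
    exact_mod_cast u
  have h1' : (A.card : ℝ) * c1 ≤ Ms.card * ℓ := by exact_mod_cast h1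
  have hc' : (c2 : ℝ) ≤ ((t : ℝ) - 1) * c1 := by
    have : (c2 : ℝ) ≤ ((t - 1 : ℕ) : ℝ) * c1 := by exact_mod_cast hc
    rwa [Nat.cast_sub (by omega), Nat.cast_one] at this
  have hc1' : (0 : ℝ) < c1 := by exact_mod_cast hc1pos
  have hl0 : (0 : ℝ) ≤ ℓ := Nat.cast_nonneg _
  refine le_of_mul_le_mul_right ?_ hc1'
  calc (b - ℓ) * (A.card : ℝ) * c1 = (b - ℓ) * ((A.card : ℝ) * c1) := by ring
    _ ≤ (b - ℓ) * (Ms.card * ℓ) := mul_le_mul_of_nonneg_left h1' (by linarith)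
    _ = (Ms.card * (b - ℓ)) * ℓ := by ring
    _ ≤ (D.card * c2) * ℓ := mul_le_mul_of_nonneg_right h2 hl0
    _ ≤ (D.card * (((t : ℝ) - 1) * c1)) * ℓ := by gcongr
    _ = ((t : ℝ) - 1) * ℓ * (D.card : ℝ) * c1 := by ring

lemma wb_q_bound (r : ℕ) (q : ℝ) (h0 : 0 ≤ q) (h1 : q ≤ 1) (hq : q ^ r = 1 / 2) :
    (1 - q) * r ≤ 1 := by
  have h := mul_neg_geom_sum q r
  have h2 : (r : ℝ) * (1 / 2) ≤ ∑ i ∈ range r, q ^ i := by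
    have := card_nsmul_le_sum (range r) (fun i => q ^ i) (1 / 2) (by
      intro i hi
      rw [← hq]
      exact pow_le_pow_of_le_one h0 h1 (mem_range.1 hi).le)
    simpa using this
  rw [hq] at h
  nlinarith [mul_le_mul_of_nonneg_left h2 (sub_nonneg.2 h1)]

lemma wb_main {V : Type*} [DecidableEq V] (t s ℓ r : ℕ) (hs1 : 1 ≤ s) (hs : s < t)
    (hl0 : 0 < ℓ) (q : ℝ) (h0 : 0 ≤ q) (h1 : q ≤ 1) (hqr : (1 - q) * r ≤ 1)
    (bs : ℝ) (hbs : (t : ℝ) * ℓ ≤ (1 - q) * (bs - ℓ))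
    (G : Finset (Finset V)) (hG : IsTComplex t G)
    (hb : ∀ K ∈ G, K.card = s → bs ≤ (complexDeg t G K : ℝ))
    (hl : ∀ K ∈ G, K.card = s + 1 → complexDeg t G K ≤ ℓ) (S : Finset V) (hS : S.card ≤ r) :
    (∀ K ∈ G.filter (fun K => Disjoint K S), K.card = s →
      bs - S.card * ℓ ≤ (complexDeg t (G.filter (fun K => Disjoint K S)) K : ℝ)) ∧
    (∀ K ∈ G.filter (fun K => Disjoint K S), K.card = s + 1 →
      complexDeg t (G.filter (fun K => Disjoint K S)) K ≤ ℓ) ∧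
    (∀ K ∈ G.filter (fun K => Disjoint K S), K.card ≤ s →
      q ^ S.card * (complexDeg t G K : ℝ)
        ≤ (complexDeg t (G.filter (fun K => Disjoint K S)) K : ℝ)) := by
  induction S using Finset.induction_on with
  | empty =>
    simp only [disjoint_empty_right, filter_true, card_empty]
    refine ⟨?_, hl, ?_⟩
    · intro K hK hc
      simpa using hb K hK hc
    · intro K hK hc
      simp
  | insert v S hvS ih =>
    rw [card_insert_of_notMem hvS] at hS ⊢
    obtain ⟨i1, i2, i3⟩ := ih (by omega)
    have hH := wb_filter_complex t G hG S
    have hEq : G.filter (fun K => Disjoint K (insert v S))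
        = (G.filter (fun K => Disjoint K S)).filter (fun L => v ∉ L) := by
      ext K
      simp only [mem_filter, disjoint_insert_right]
      tauto
    rw [hEq]
    set H := G.filter (fun K => Disjoint K S) with hHdef
    have hl0' : (1 : ℝ) ≤ ℓ := by exact_mod_cast hl0
    have ht : (2 : ℝ) ≤ t := by exact_mod_cast (by omega : 2 ≤ t)
    have hSr : (S.card : ℝ) + 1 ≤ r := by exact_mod_cast hS
    have hSn : (0 : ℝ) ≤ S.card := Nat.cast_nonneg _
    have hq1 : (1 - q) * S.card ≤ 1 :=
      (mul_le_mul_of_nonneg_left (by linarith) (by linarith)).trans hqr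
    have hkey : ((t : ℝ) - 1) * ℓ ≤ (1 - q) * (bs - S.card * ℓ - ℓ) := by
      nlinarith [mul_le_mul_of_nonneg_right hq1 (by linarith : (0 : ℝ) ≤ ℓ)]
    have hpos : 0 < bs - S.card * ℓ - ℓ := by
      by_contra hcon
      push Not at hcon
      have : (1 - q) * (bs - S.card * ℓ - ℓ) ≤ 0 :=
        mul_nonpos_of_nonneg_of_nonpos (by linarith) hcon
      nlinarith
    refine ⟨?_, ?_, ?_⟩
    · intro K hK hc
      rw [mem_filter] at hK
      have a1 := i1 K hK.1 hc
      have a2 := wb_deg_insert_le t s ℓ H hH i2 K v hc hK.2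
      have a3 := wb_deg_split t H K v
      have a4 : (complexDeg t H K : ℝ)
          ≤ ℓ + (complexDeg t (H.filter (fun L => v ∉ L)) K : ℝ) := by
        exact_mod_cast (by omega : complexDeg t H K
          ≤ ℓ + complexDeg t (H.filter (fun L => v ∉ L)) K)
      push_cast
      linarith
    · intro K hK hc
      rw [mem_filter] at hK
      have a1 := i2 K hK.1 hc
      have a3 := wb_deg_split t H K v
      omega
    · intro K hK hc
      rw [mem_filter] at hK
      have hKpos : 1 ≤ K.card := card_pos.2 (hH K hK.1).1
      have a1 := i3 K hK.1 hc
      have a2 := wb_step t s ℓ hs (bs - S.card * ℓ) H hH i1 i2 (by linarith) K hKpos hc v hK.2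
      have a3 : (complexDeg t H K : ℝ) = complexDeg t H (insert v K)
          + complexDeg t (H.filter (fun L => v ∉ L)) K := by
        exact_mod_cast wb_deg_split t H K v
      set x : ℝ := (complexDeg t H (insert v K) : ℝ)
      set y : ℝ := (complexDeg t (H.filter (fun L => v ∉ L)) K : ℝ)
      have hx : 0 ≤ x := Nat.cast_nonneg _
      have hy : 0 ≤ y := Nat.cast_nonneg _
      have a4 : x ≤ (1 - q) * y := by
        refine le_of_mul_le_mul_left ?_ hpos
        calc _ ≤ _ := a2
          _ ≤ (1 - q) * (bs - S.card * ℓ - ℓ) * y := mul_le_mul_of_nonneg_right hkey hy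
          _ = _ := by ring
      rw [pow_succ]
      have a5 : q * (x + y) ≤ y := by nlinarith
      calc _ = q * (q ^ S.card * (complexDeg t G K : ℝ)) := by ring
        _ ≤ q * (x + y) := by rw [← a3]; exact mul_le_mul_of_nonneg_left a1 h0
        _ ≤ y := a5

/-- A weak-builder whose parameters satisfy `(B_s - ℓ)/(C(t,s)·ℓ) ≥ 1/(1 - 2^{-1/r})`
is a strong-builder with thresholds halved. -/
theorem weak_builder_to_strong_builder {V : Type*} [DecidableEq V]
    (t s ℓ r : ℕ) (hs : s < t) (hr : 1 ≤ r)
    (B : ℕ → ℝ) (𝒢 : Finset (Finset V))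
    (hweak : IsWeakBuilder t s ℓ B 𝒢)
    (hineq : (1 : ℝ) / (1 - 2 ^ (-(1 : ℝ) / (r : ℝ))) ≤ (B s - ℓ) / ((t.choose s : ℝ) * ℓ)) :
    IsStrongBuilder t s ℓ r (fun i => B i / 2) 𝒢 := by
  classical
  obtain ⟨hG, hB, hL⟩ := hweak
  have hL' : ∀ K ∈ 𝒢, K.card = s + 1 → complexDeg t 𝒢 K ≤ ℓ :=
    fun K hK hc => by exact_mod_cast hL K hK hc
  intro S hS
  have hrpos : (0 : ℝ) < r := by exact_mod_cast hr
  rw [wb_remove_eq t 𝒢 hG S]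
  refine ⟨wb_filter_complex t 𝒢 hG S, ?_, ?_⟩
  · intro i hi1 his K hK hKi
    have hs1 : 1 ≤ s := hi1.trans his
    set q : ℝ := 2 ^ (-(1 : ℝ) / (r : ℝ)) with hq
    have hq0 : 0 < q := Real.rpow_pos_of_pos (by norm_num) _
    have hqlt : q < 1 :=
      Real.rpow_lt_one_of_one_lt_of_neg (by norm_num) (div_neg_of_neg_of_pos (by norm_num) hrpos)
    have hqr : q ^ r = 1 / 2 := by
      rw [hq, ← Real.rpow_natCast, ← Real.rpow_mul (by norm_num), div_mul_cancel₀ _ hrpos.ne',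
        Real.rpow_neg_one]
      norm_num
    have hl0 : 0 < ℓ := by
      rcases Nat.eq_zero_or_pos ℓ with h | h
      · subst h
        have : 0 < 1 / (1 - q) := one_div_pos.2 (by linarith)
        simp at hineq
        linarith
      · exact h
    have hl0' : (0 : ℝ) < ℓ := by exact_mod_cast hl0
    have hct : (t : ℝ) ≤ t.choose s := by exact_mod_cast wb_choose_ge t s hs1 hs
    have hcpos : (0 : ℝ) < t.choose s := by exact_mod_cast Nat.choose_pos hs.le
    rw [div_le_div_iff₀ (by linarith) (by positivity)] at hineq
    have hbs : (t : ℝ) * ℓ ≤ (1 - q) * (B s - ℓ) := by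
      nlinarith [mul_le_mul_of_nonneg_right hct hl0'.le]
    have hm := (wb_main t s ℓ r hs1 hs hl0 q hq0.le hqlt.le
      (wb_q_bound r q hq0.le hqlt.le hqr) (B s) hbs 𝒢 hG
      (fun K hK hc => hB s hs1 le_rfl K hK hc) hL' S hS).2.2 K hK (by omega)
    have hp : (1 / 2 : ℝ) ≤ q ^ S.card := by
      rw [← hqr]
      exact pow_le_pow_of_le_one hq0.le hqlt.le hS
    have hd := hB i hi1 his K (mem_filter.1 hK).1 hKi
    have hdn : (0 : ℝ) ≤ complexDeg t 𝒢 K := Nat.cast_nonneg _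
    have := mul_le_mul_of_nonneg_right hp hdn
    change B i / 2 ≤ _
    linarith
  · intro K hK hc
    refine le_trans ?_ (hL K (mem_filter.1 hK).1 hc)
    have : complexDeg t (𝒢.filter (fun K => Disjoint K S)) K ≤ complexDeg t 𝒢 K :=
      card_le_card (filter_subset_filter _ (filter_subset _ _))
    exact_mod_cast this
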